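/- arXiv:1706.08500 — 2 statements merged into one kernel-verified Lean document; each statement's English description precedes it below -/
import Mathlib

section
/- Let m ≥ 1 and K ≥ 1 be natural numbers, and let p : Fin m → Fin K → ℝ be such that p i k ≥ 0 for all i, k and ∑_{k} p i k = 1 for every i. Define the marginal q k = (1/m) ∑_{i} p i k, and define the Inception Score IS = exp( (1/m) ∑_{i} ∑_{k} p i k · log(p i k / q k) ), where a summand with p i k = 0 is interpreted as 0. Then IS ≤ m. -/
open Finset

/-- The Inception Score `IS = exp((1/m) ∑ i ∑ k, p i k * log (p i k / q k))`
(with summands where `p i k = 0` interpreted as `0`) is bounded above by the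
number of samples `m`. -/
theorem inceptionScore_le_card
    (m K : ℕ) (hm : 1 ≤ m) (hK : 1 ≤ K)
    (p : Fin m → Fin K → ℝ)
    (hp_nonneg : ∀ i k, 0 ≤ p i k)
    (hp_sum : ∀ i, ∑ k, p i k = 1)
    (q : Fin K → ℝ)
    (hq : ∀ k, q k = (1 / (m : ℝ)) * ∑ i, p i k)
    (IS : ℝ)
    (hIS : IS = Real.exp ((1 / (m : ℝ)) * ∑ i, ∑ k,
      (if p i k = 0 then 0 else p i k * Real.log (p i k / q k)))) :
    IS ≤ m := by
  have hm_pos : (0 : ℝ) < m := by exact_mod_cast hm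
  have term_le (i : Fin m) (k : Fin K) :
      (if p i k = 0 then 0 else p i k * Real.log (p i k / q k)) ≤ p i k * Real.log m := by
    split_ifs with h
    · simp [h]
    · have hp_pos : 0 < p i k := (hp_nonneg i k).lt_of_ne' h
      have hp_le : p i k ≤ ∑ j, p j k :=
        single_le_sum (f := fun j => p j k) (fun j _ => hp_nonneg j k) (mem_univ i)
      have hq_eq : m * q k = ∑ j, p j k := by
        rw [hq]
        field_simp
      have hq_pos : 0 < q k := pos_of_mul_pos_right (by linarith) hm_pos.le
      have ratio_le : p i k / q k ≤ m := by
        rw [div_le_iff₀ hq_pos]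
        linarith
      gcongr
  have sum_le : ∑ i, ∑ k, (if p i k = 0 then 0 else p i k * Real.log (p i k / q k))
      ≤ m * Real.log m :=
    calc
      _ ≤ ∑ i, ∑ k, p i k * Real.log m :=
        sum_le_sum fun i _ => sum_le_sum fun k _ => term_le i k
      _ = m * Real.log m := by simp [← sum_mul, hp_sum]
  rw [hIS, ← Real.le_log_iff_exp_le hm_pos, one_div, inv_mul_le_iff₀ hm_pos]
  exact sum_le
end

section
/- Let d ≥ 1, let f : ℝᵈ → ℝ be differentiable with continuous gradient ∇f, let α > 0, and let θ : ℝ → ℝᵈ be differentiable with derivative satisfying the polynomially-memoried integro-differential equation θ'(t) = −t^{−(α+1)} ∫_0^t (α+1) s^{α} ∇f(θ(s)) ds for all t > 0. Then θ' is differentiable on (0, ∞) and θ satisfies θ''(t) + ((α+1)/t)·θ'(t) + ((α+1)/t)·∇f(θ(t)) = 0 for all t > 0; i.e., polynomial memory yields a Heavy Ball with Friction dynamics with time-dependent damping coefficient proportional to 1/t. -/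
/-- Polynomially memoried integro-differential equation
`θ'(t) = -t^{-(α+1)} ∫₀ᵗ (α+1) s^α ∇f(θ(s)) ds` implies a Heavy Ball with
Friction dynamics with time-dependent damping:
`θ''(t) + ((α+1)/t) θ'(t) + ((α+1)/t) ∇f(θ(t)) = 0` for `t > 0`. -/
theorem poly_memory_integro_differential_eq_hbf
    (d : ℕ) (hd : 1 ≤ d)
    (f : EuclideanSpace ℝ (Fin d) → ℝ)
    (gradf : EuclideanSpace ℝ (Fin d) → EuclideanSpace ℝ (Fin d))
    (hf : ∀ x, HasGradientAt f (gradf x) x)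
    (hgc : Continuous gradf)
    (α : ℝ) (hα : 0 < α)
    (θ θ' : ℝ → EuclideanSpace ℝ (Fin d))
    (hθ : ∀ t, HasDerivAt θ (θ' t) t)
    (hint : ∀ t : ℝ, 0 < t →
      θ' t = -(t ^ (-(α + 1)) •
        ∫ s in (0 : ℝ)..t, ((α + 1) * s ^ α) • gradf (θ s))) :
    ∀ t : ℝ, 0 < t →
      HasDerivAt θ'
        (-(((α + 1) / t) • θ' t) - ((α + 1) / t) • gradf (θ t)) t := by
  intro t ht
  have hθc : Continuous θ := continuous_iff_continuousAt.2 fun s => (hθ s).continuousAt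
  have hc : Continuous fun s : ℝ => ((α + 1) * s ^ α) • gradf (θ s) :=
    (continuous_const.mul (Real.continuous_rpow_const hα.le)).smul (hgc.comp hθc)
  have hI := hc.integral_hasStrictDerivAt 0 t |>.hasDerivAt
  have hp : HasDerivAt (fun u : ℝ => u ^ (-(α + 1))) (-(α + 1) * t ^ (-(α + 1) - 1)) t :=
    Real.hasDerivAt_rpow_const (Or.inl ht.ne')
  refine ((hp.smul hI).neg.congr_of_eventuallyEq ?_).congr_deriv ?_
  · filter_upwards [lt_mem_nhds ht] with u hu using hint u hu
  have h1 : t ^ (-(α + 1) - 1) = t ^ (-(α + 1)) / t := Real.rpow_sub_one ht.ne' _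
  have h2 : t ^ (-(α + 1)) * t ^ α = t⁻¹ := by
    rw [← Real.rpow_add ht, ← Real.rpow_neg_one]
    congr 1
    ring
  have h3 : t ^ (-(α + 1)) * ((α + 1) * t ^ α) = (α + 1) / t := by
    rw [mul_left_comm, h2, div_eq_mul_inv]
  rw [hint t ht, h1, smul_smul, h3]
  module
end
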